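/- arXiv:1410.6045 — 7 statements merged into one kernel-verified Lean document; each statement's English description precedes it below -/
import Mathlib

section
/- The ℝ-linear map f : ℂ³ → ℂ³ defined by f(u1,u2,u3) = (u1, (u2 − i·conj(u3))/√2, (conj(u2) − i·u3)/√2) is an ℝ-linear bijection satisfying: (a) ω₀(f(u), f(v)) = ω(u,v) for all u,v ∈ ℂ³, where ω₀(x,y) = 2·(Im(x1·conj(y1)) + Im(x2·conj(y2)) + Im(x3·conj(y3))) is the standard Kähler form of ℂ³; and (b) f(ζ²·u1, ζ²·u2, ζ⁴·u3) = (ζ²·f(u)1, ζ²·f(u)2, ζ⁴·f(u)3) for all u ∈ ℂ³, i.e. f conjugates the action of the generator of the isotropy group K = ℤ₃ into the unitary transformation diag(ζ², ζ², ζ⁴). (Hence the complex and symplectic inclusions ι, ι' : K → U(3) coincide at the isolated orbifold points.) -/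
/-- `ζ = e^{iπ/3}`, a primitive 6th root of unity. -/
noncomputable def zeta : ℂ := Complex.exp (Real.pi * Complex.I / 3)

/-- The alternating ℝ-bilinear form on `ℂ³` given by
`ω(u,v) = 2·Im(u1·conj(v1)) + 2·Re(u2·v3 − u3·v2)`. -/
noncomputable def omegaForm (u v : ℂ × ℂ × ℂ) : ℝ :=
  2 * (u.1 * (starRingEnd ℂ) v.1).im + 2 * (u.2.1 * v.2.2 - u.2.2 * v.2.1).re

/-- The standard Kähler form of `ℂ³`:
`ω₀(x,y) = 2·(Im(x1·conj(y1)) + Im(x2·conj(y2)) + Im(x3·conj(y3)))`. -/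
noncomputable def omegaStd (x y : ℂ × ℂ × ℂ) : ℝ :=
  2 * ((x.1 * (starRingEnd ℂ) y.1).im + (x.2.1 * (starRingEnd ℂ) y.2.1).im
    + (x.2.2 * (starRingEnd ℂ) y.2.2).im)

/-- The change of variables `f(u1,u2,u3) = (u1, (u2 − i·conj(u3))/√2, (conj(u2) − i·u3)/√2)`. -/
noncomputable def fChange (u : ℂ × ℂ × ℂ) : ℂ × ℂ × ℂ :=
  (u.1, (u.2.1 - Complex.I * (starRingEnd ℂ) u.2.2) / (Real.sqrt 2 : ℂ),
    ((starRingEnd ℂ) u.2.1 - Complex.I * u.2.2) / (Real.sqrt 2 : ℂ))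

theorem zeta_pow_six : zeta ^ 6 = 1 := by
  unfold zeta
  rw [← Complex.exp_nat_mul, ← Complex.exp_two_pi_mul_I]
  congr 1
  push_cast
  ring

theorem conj_zeta_mul : (starRingEnd ℂ) zeta * zeta = 1 := by
  unfold zeta
  rw [← Complex.exp_conj, ← Complex.exp_add, ← Complex.exp_zero]
  congr 1
  have h3 : (starRingEnd ℂ) 3 = 3 := Complex.conj_ofNat 3
  simp [h3]
  ring

theorem conj_zeta : (starRingEnd ℂ) zeta = zeta ^ 5 := by
  linear_combination zeta ^ 5 * conj_zeta_mul - (starRingEnd ℂ) zeta * zeta_pow_six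

theorem sqrt_two_sq : (Real.sqrt 2 : ℂ) ^ 2 = 2 := by
  rw [← Complex.ofReal_pow, Real.sq_sqrt (by norm_num)]
  norm_num

theorem sqrt_two_ne : (Real.sqrt 2 : ℂ) ≠ 0 := by
  intro h
  have := sqrt_two_sq
  rw [h] at this
  norm_num at this

/-- `f` is an ℝ-linear bijection taking `ω` to the standard Kähler form `ω₀` of `ℂ³` and
conjugating the action of the generator `ρ²` of `K = ℤ₃`, namely
`(u1,u2,u3) ↦ (ζ²·u1, ζ²·u2, ζ⁴·u3)`, into the unitary transformation `diag(ζ², ζ², ζ⁴)`. -/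
theorem stmt6 :
    Function.Bijective fChange ∧
    (∀ u v : ℂ × ℂ × ℂ, fChange (u + v) = fChange u + fChange v) ∧
    (∀ (a : ℝ) (u : ℂ × ℂ × ℂ), fChange (a • u) = a • fChange u) ∧
    (∀ u v : ℂ × ℂ × ℂ, omegaStd (fChange u) (fChange v) = omegaForm u v) ∧
    (∀ u : ℂ × ℂ × ℂ,
      fChange (zeta ^ 2 * u.1, zeta ^ 2 * u.2.1, zeta ^ 4 * u.2.2)
        = (zeta ^ 2 * (fChange u).1, zeta ^ 2 * (fChange u).2.1,
            zeta ^ 4 * (fChange u).2.2)) := by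
  have hs := sqrt_two_sq
  have hs0 := sqrt_two_ne
  have hI := Complex.I_sq
  refine ⟨?_, ?_, ?_, ?_, ?_⟩
  · refine Function.bijective_iff_has_inverse.mpr ⟨fun x =>
      (x.1, (x.2.1 + (starRingEnd ℂ) x.2.2) / (Real.sqrt 2 : ℂ),
        -Complex.I * ((starRingEnd ℂ) x.2.1 - x.2.2) / (Real.sqrt 2 : ℂ)), ?_, ?_⟩
    · rintro ⟨a, b, c⟩
      simp only [fChange, map_div₀, map_sub, map_mul, Complex.conj_conj, Complex.conj_I,
        Complex.conj_ofReal, Prod.mk.injEq, true_and]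
      constructor
      · field_simp
        rw [hs]
        ring
      · field_simp
        rw [hs]
        linear_combination (-2 * c) * hI
    · rintro ⟨a, b, c⟩
      simp only [fChange, map_div₀, map_sub, map_add, map_neg, map_mul, Complex.conj_conj,
        Complex.conj_I, Complex.conj_ofReal, Prod.mk.injEq, true_and]
      constructor
      · field_simp
        rw [hs]
        linear_combination ((starRingEnd ℂ) c - b) * hI
      · field_simp
        rw [hs]
        linear_combination ((starRingEnd ℂ) b - c) * hI
  · rintro ⟨a, b, c⟩ ⟨a', b', c'⟩
    simp only [fChange, Prod.mk_add_mk, map_add, Prod.mk.injEq, true_and]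
    constructor <;> ring
  · rintro r ⟨a, b, c⟩
    simp only [fChange, Prod.smul_mk, Complex.real_smul, map_mul, Complex.conj_ofReal,
      Prod.mk.injEq, true_and]
    constructor <;> ring
  · rintro ⟨a, b, c⟩ ⟨a', b', c'⟩
    have key : ∀ z w : ℂ, (z / (Real.sqrt 2 : ℂ)) * (starRingEnd ℂ) (w / (Real.sqrt 2 : ℂ))
        = z * (starRingEnd ℂ) w / (2 : ℝ) := by
      intro z w
      simp only [map_div₀, Complex.conj_ofReal]
      rw [div_mul_div_comm, ← pow_two, hs]
      norm_num
    simp only [fChange, omegaStd, omegaForm, key, Complex.div_ofReal_im]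
    simp
    ring
  · rintro ⟨a, b, c⟩
    simp only [fChange, map_mul, map_pow, conj_zeta, Prod.mk.injEq, true_and]
    have h6 := zeta_pow_six
    have h20 : (zeta ^ 5) ^ 4 = zeta ^ 2 := by
      rw [← pow_mul, show 5 * 4 = 6 * 3 + 2 by norm_num, pow_add, pow_mul, h6]
      ring
    have h10 : (zeta ^ 5) ^ 2 = zeta ^ 4 := by
      rw [← pow_mul, show 5 * 2 = 6 * 1 + 4 by norm_num, pow_add, pow_mul, h6]
      ring
    rw [h20, h10]
    constructor <;> ring
end

section
/- The ℝ-linear map g : ℂ² → ℂ² defined by g(u2,u3) = ((u2 − i·conj(u3))/√2, (conj(u2) − i·u3)/√2) is an ℝ-linear bijection satisfying: (a) ω₀(g(u), g(v)) = 2·Re(u2·v3 − u3·v2) for all u = (u2,u3), v = (v2,v3) ∈ ℂ², where ω₀(x,y) = 2·(Im(x1·conj(y1)) + Im(x2·conj(y2))) is the standard Kähler form of ℂ²; and (b) g(ζ·u2, ζ⁵·u3) = (ζ·g(u)1, ζ⁵·g(u)2) for all u ∈ ℂ², i.e. g conjugates the generator of the ℤ₆-action on ℂ² into the unitary transformation diag(ζ,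 ζ⁵). (Hence the complex and symplectic inclusions ι, ι' : H×K → U(2) coincide along the singular surface S₀.) -/
/-- The standard Kähler form of `ℂ²`: `ω₀(x,y) = 2·(Im(x1·conj(y1)) + Im(x2·conj(y2)))`. -/
noncomputable def omegaStd2 (x y : ℂ × ℂ) : ℝ :=
  2 * ((x.1 * (starRingEnd ℂ) y.1).im + (x.2 * (starRingEnd ℂ) y.2).im)

/-- The change of variables `g(u2,u3) = ((u2 − i·conj(u3))/√2, (conj(u2) − i·u3)/√2)`. -/
noncomputable def gChange (u : ℂ × ℂ) : ℂ × ℂ :=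
  ((u.1 - Complex.I * (starRingEnd ℂ) u.2) / (Real.sqrt 2 : ℂ),
    ((starRingEnd ℂ) u.1 - Complex.I * u.2) / (Real.sqrt 2 : ℂ))

/-- `g` is an ℝ-linear bijection taking the symplectic form
`(u,v) ↦ 2·Re(u2·v3 − u3·v2)` (the value of `du2∧du3 + dū2∧dū3`) to the standard Kähler
form `ω₀` of `ℂ²`, and conjugating the generator `(u2,u3) ↦ (ζ·u2, ζ⁵·u3)` of the
`ℤ₆`-action into the unitary transformation `diag(ζ, ζ⁵)`. -/
theorem stmt7 :
    Function.Bijective gChange ∧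
    (∀ u v : ℂ × ℂ, gChange (u + v) = gChange u + gChange v) ∧
    (∀ (a : ℝ) (u : ℂ × ℂ), gChange (a • u) = a • gChange u) ∧
    (∀ u v : ℂ × ℂ,
      omegaStd2 (gChange u) (gChange v) = 2 * (u.1 * v.2 - u.2 * v.1).re) ∧
    (∀ u : ℂ × ℂ,
      gChange (zeta * u.1, zeta ^ 5 * u.2)
        = (zeta * (gChange u).1, zeta ^ 5 * (gChange u).2)) := by
  have h2 : (Real.sqrt 2 : ℂ) * (Real.sqrt 2 : ℂ) = 2 := by
    rw [← Complex.ofReal_mul, Real.mul_self_sqrt (by norm_num)]; norm_num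
  have h0 : (Real.sqrt 2 : ℂ) ≠ 0 := by
    intro h; rw [h] at h2; norm_num at h2
  have hI := Complex.I_mul_I
  have hz6 : zeta ^ 6 = 1 := by
    unfold zeta
    rw [← Complex.exp_nat_mul, ← Complex.exp_two_pi_mul_I]
    congr 1; push_cast; ring
  have hzc : zeta * (starRingEnd ℂ) zeta = 1 := by
    unfold zeta
    rw [← Complex.exp_conj, ← Complex.exp_add, ← Complex.exp_zero]
    congr 1
    simp only [map_div₀, map_mul, Complex.conj_ofReal, Complex.conj_I, map_ofNat]
    ring
  have hz0 : zeta ≠ 0 := by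
    intro h; rw [h] at hzc; norm_num at hzc
  have hc : (starRingEnd ℂ) zeta = zeta ^ 5 := by
    apply mul_left_cancel₀ hz0
    rw [hzc, ← hz6]; ring
  have hc5 : (starRingEnd ℂ) zeta ^ 5 = zeta := by
    rw [hc]
    calc (zeta ^ 5) ^ 5 = (zeta ^ 6) ^ 4 * zeta := by ring
      _ = zeta := by rw [hz6]; ring
  refine ⟨?_, ?_, ?_, ?_, ?_⟩
  · rw [Function.bijective_iff_has_inverse]
    refine ⟨fun x => ((x.1 + (starRingEnd ℂ) x.2) / (Real.sqrt 2 : ℂ),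
      -Complex.I * ((starRingEnd ℂ) x.1 - x.2) / (Real.sqrt 2 : ℂ)), ?_, ?_⟩
    · rintro ⟨a, b⟩
      simp only [gChange, map_div₀, map_sub, map_mul, Complex.conj_ofReal, Complex.conj_I,
        Complex.conj_conj, Prod.mk.injEq]
      constructor <;> field_simp <;> grind
    · rintro ⟨a, b⟩
      simp only [gChange, map_div₀, map_sub, map_add, map_neg, map_mul, Complex.conj_ofReal,
        Complex.conj_I, Complex.conj_conj, Prod.mk.injEq]
      constructor <;> field_simp <;> grind
  · intro u v
    simp only [gChange, Prod.fst_add, Prod.snd_add, map_add, Prod.mk_add_mk, Prod.mk.injEq]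
    constructor <;> ring
  · intro a u
    simp only [gChange, Prod.smul_fst, Prod.smul_snd, Prod.smul_mk, Complex.real_smul, map_mul,
      Complex.conj_ofReal, Prod.mk.injEq]
    constructor <;> ring
  · intro u v
    have key : ∀ x y : ℂ, x / (Real.sqrt 2 : ℂ) * (starRingEnd ℂ) (y / (Real.sqrt 2 : ℂ))
        = ((1 / 2 : ℝ) : ℂ) * (x * (starRingEnd ℂ) y) := by
      intro x y
      rw [map_div₀, Complex.conj_ofReal, div_mul_div_comm, h2]
      push_cast; ring
    simp only [omegaStd2, gChange, key, Complex.re_ofReal_mul, Complex.im_ofReal_mul]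
    simp [Complex.mul_re, Complex.mul_im]
    ring
  · intro u
    simp only [gChange, map_mul, map_pow, hc5, Prod.mk.injEq]
    rw [hc]
    constructor <;> ring
end

section
/- The set of fixed points of multiplication by ζ⁴ on the torus ℂ/Λ consists of exactly three points: {u ∈ ℂ : ζ⁴·u − u ∈ Λ} = Λ ∪ ((1+ζ)/3 + Λ) ∪ (2(1+ζ)/3 + Λ). -/
/-- The lattice `Λ = {a + bζ : a, b ∈ ℤ} ⊆ ℂ`. -/
noncomputable def Lam : Set ℂ := {z | ∃ a b : ℤ, z = (a : ℂ) + (b : ℂ) * zeta}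

theorem zeta_sq : zeta ^ 2 = zeta - 1 := by
  have h : zeta = 1 / 2 + (Real.sqrt 3 : ℂ) / 2 * Complex.I := by
    have e : (Real.pi : ℂ) * Complex.I / 3 = ((Real.pi / 3 : ℝ) : ℂ) * Complex.I := by
      push_cast; ring
    rw [zeta, e, Complex.exp_mul_I, ← Complex.ofReal_cos, ← Complex.ofReal_sin,
      Real.cos_pi_div_three, Real.sin_pi_div_three]
    push_cast; ring
  have h3 : (Real.sqrt 3 : ℂ) ^ 2 = 3 := by
    rw [← Complex.ofReal_pow, Real.sq_sqrt (by norm_num)]; norm_num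
  rw [h]
  linear_combination (1 / 4 : ℂ) * Complex.I ^ 2 * h3 + (3 / 4 : ℂ) * Complex.I_sq

/-- The fixed points of multiplication by `ζ⁴` on the torus `ℂ/Λ` are exactly the three
points `Λ`, `(1+ζ)/3 + Λ` and `2(1+ζ)/3 + Λ`. -/
theorem stmt8 :
    {u : ℂ | zeta ^ 4 * u - u ∈ Lam}
      = Lam ∪ ((fun w : ℂ => (1 + zeta) / 3 + w) '' Lam)
          ∪ ((fun w : ℂ => 2 * (1 + zeta) / 3 + w) '' Lam) := by
  have hz := zeta_sq
  have h4 : zeta ^ 4 = -zeta := by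
    linear_combination (zeta ^ 2 + zeta) * hz
  ext u
  simp only [Set.mem_ofPred_eq, Set.mem_union, Set.mem_image, h4]
  constructor
  · rintro ⟨a, b, h⟩
    have hu : u = (-(2 * a + b) + (a - b) * zeta) / 3 := by
      linear_combination (-(2 - zeta) / 3) * h + (u / 3 + (b : ℂ) / 3) * hz
    obtain ⟨k, hk⟩ : ∃ k : ℤ, a - b = 3 * k ∨ a - b = 3 * k + 1 ∨ a - b = 3 * k + 2 :=
      ⟨(a - b) / 3, by omega⟩
    rcases hk with hk | hk | hk
    · have hc : (a : ℂ) - b = 3 * k := by exact_mod_cast hk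
      refine Or.inl (Or.inl ⟨k - a, k, ?_⟩)
      push_cast
      linear_combination hu + (1 + zeta) / 3 * hc
    · have hc : (a : ℂ) - b = 3 * k + 1 := by exact_mod_cast hk
      refine Or.inl (Or.inr ⟨_, ⟨k - a, k, rfl⟩, ?_⟩)
      push_cast
      linear_combination -hu - (1 + zeta) / 3 * hc
    · have hc : (a : ℂ) - b = 3 * k + 2 := by exact_mod_cast hk
      refine Or.inr ⟨_, ⟨k - a, k, rfl⟩, ?_⟩
      push_cast
      linear_combination -hu - (1 + zeta) / 3 * hc
  · rintro ((⟨m, n, rfl⟩ | ⟨_, ⟨m, n, rfl⟩, rfl⟩) | ⟨_, ⟨m, n, rfl⟩, rfl⟩)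
    · refine ⟨-(m - n), -(m + 2 * n), ?_⟩
      push_cast
      linear_combination (-(n : ℂ)) * hz
    · refine ⟨-(m - n), -(m + 2 * n) - 1, ?_⟩
      push_cast
      linear_combination (-(n : ℂ) - 1 / 3) * hz
    · refine ⟨-(m - n), -(m + 2 * n) - 2, ?_⟩
      push_cast
      linear_combination (-(n : ℂ) - 2 / 3) * hz
end

section
/- For every p, q ∈ {0, 1/2, ζ/2, (1+ζ)/2} and every u1 ∈ ℂ, the element γ = (0, −2p, −2q) lies in Γ and satisfies ρ³(u1, p, p·u1 + q) = γ · (u1, p, p·u1 + q) in the Heisenberg group, where ρ³(u1,u2,u3) = (u1, −u2, −u3). (Hence each torus S_{(p,q)} = {(u1, p, p·u1+q) : u1 ∈ ℂ/Λ} in the nilmanifold M = Γ\G is pointwise fixed by ρ³, so consists of points of order 2 with isotropy H = {id, ρ³}.) -/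
/-- The product of the complex Heisenberg group `G = ℂ³`. -/
def Hmul (p q : ℂ × ℂ × ℂ) : ℂ × ℂ × ℂ :=
  (p.1 + q.1, p.2.1 + q.2.1, p.2.2 + q.2.2 + p.2.1 * q.1)

/-- `Γ = {(u1,u2,u3) : u1, u2, u3 ∈ Λ}`. -/
noncomputable def Gam : Set (ℂ × ℂ × ℂ) := {u | u.1 ∈ Lam ∧ u.2.1 ∈ Lam ∧ u.2.2 ∈ Lam}

/-- The map `ρ(u1,u2,u3) = (ζ⁴·u1, ζ·u2, ζ⁵·u3)`. -/
noncomputable def rho (u : ℂ × ℂ × ℂ) : ℂ × ℂ × ℂ :=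
  (zeta ^ 4 * u.1, zeta * u.2.1, zeta ^ 5 * u.2.2)

theorem zeta_cube : zeta ^ 3 = -1 := by
  unfold zeta
  rw [← Complex.exp_nat_mul, ← Complex.exp_pi_mul_I]
  congr 1
  push_cast
  ring

theorem neg_two_mul_mem (p : ℂ)
    (hp : p ∈ ({0, 1 / 2, zeta / 2, (1 + zeta) / 2} : Set ℂ)) : -2 * p ∈ Lam := by
  simp only [Set.mem_insert_iff, Set.mem_singleton_iff] at hp
  rcases hp with rfl | rfl | rfl | rfl
  · exact ⟨0, 0, by simp⟩
  · exact ⟨-1, 0, by push_cast; ring⟩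
  · exact ⟨0, -1, by push_cast; ring⟩
  · exact ⟨-1, -1, by push_cast; ring⟩

/-- For `p, q ∈ {0, 1/2, ζ/2, (1+ζ)/2}` and any `u1 ∈ ℂ`, the element `γ = (0, −2p, −2q)`
lies in `Γ` and `ρ³(u1, p, p·u1 + q) = γ · (u1, p, p·u1 + q)`; hence the torus `S_{(p,q)}`
in `M = Γ\G` is pointwise fixed by `ρ³`. -/
theorem stmt11 (p q : ℂ)
    (hp : p ∈ ({0, 1 / 2, zeta / 2, (1 + zeta) / 2} : Set ℂ))
    (hq : q ∈ ({0, 1 / 2, zeta / 2, (1 + zeta) / 2} : Set ℂ)) (u1 : ℂ) :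
    ((0, -2 * p, -2 * q) : ℂ × ℂ × ℂ) ∈ Gam ∧
    rho^[3] (u1, p, p * u1 + q) = Hmul (0, -2 * p, -2 * q) (u1, p, p * u1 + q) := by
  refine ⟨⟨⟨0, 0, by simp⟩, neg_two_mul_mem p hp, neg_two_mul_mem q hq⟩, ?_⟩
  have h := zeta_cube
  simp only [Function.iterate_succ, Function.iterate_zero, Function.comp, id, rho, Hmul,
    Prod.mk.injEq]
  have h12 : zeta ^ 12 = 1 := by
    rw [show zeta ^ 12 = (zeta ^ 3) ^ 4 by ring, h]; norm_num
  have h15 : zeta ^ 15 = -1 := by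
    rw [show zeta ^ 15 = (zeta ^ 3) ^ 5 by ring, h]; norm_num
  refine ⟨?_, ?_, ?_⟩
  · linear_combination u1 * h12
  · linear_combination p * h
  · linear_combination (p * u1 + q) * h15
end

section
/- For every a, b, c ∈ {0, 1, 2}, the point u = (a(1+ζ)/3, b(1+ζ)/3, c(1+ζ)/3 + (2/9)·a·b·(1+ζ)²) ∈ ℂ³ satisfies ρ²(u) = γ · u in the Heisenberg group for some γ ∈ Γ (explicitly γ = (−a, −b, −cζ + ab(1−ζ))), where ρ²(u1,u2,u3) = (ζ²·u1, ζ²·u2, ζ⁴·u3). (Hence these 27 points descend to points of the nilmanifold M = Γ\G fixed by ρ², i.e. with isotropy containing K = {id, ρ², ρ⁴}.) -/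
/-- For `a, b, c ∈ {0,1,2}`, the point
`u = (a(1+ζ)/3, b(1+ζ)/3, c(1+ζ)/3 + (2/9)·a·b·(1+ζ)²)` satisfies `ρ²(u) = γ · u` for some
`γ ∈ Γ` (explicitly `γ = (−a, −b, −cζ + ab(1−ζ))`); hence these points descend to points
of `M = Γ\G` fixed by `ρ²`. -/
theorem stmt12 (a b c : ℤ) (ha : a ∈ ({0, 1, 2} : Set ℤ)) (hb : b ∈ ({0, 1, 2} : Set ℤ))
    (hc : c ∈ ({0, 1, 2} : Set ℤ)) :
    ∃ γ ∈ Gam,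
      γ = ((-a : ℂ), (-b : ℂ), -(c : ℂ) * zeta + (a : ℂ) * (b : ℂ) * (1 - zeta)) ∧
      rho^[2] ((a : ℂ) * (1 + zeta) / 3, (b : ℂ) * (1 + zeta) / 3,
          (c : ℂ) * (1 + zeta) / 3 + (2 / 9 : ℂ) * (a : ℂ) * (b : ℂ) * (1 + zeta) ^ 2)
        = Hmul γ ((a : ℂ) * (1 + zeta) / 3, (b : ℂ) * (1 + zeta) / 3,
            (c : ℂ) * (1 + zeta) / 3 + (2 / 9 : ℂ) * (a : ℂ) * (b : ℂ) * (1 + zeta) ^ 2) := by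
  have h2 : zeta ^ 2 = zeta - 1 := zeta_sq
  have h4 : zeta ^ 4 = -zeta := by linear_combination (zeta ^ 2 + zeta) * h2
  have h5 : zeta ^ 5 = 1 - zeta := by linear_combination zeta * h4 - h2
  refine ⟨_, ⟨⟨-a, 0, ?_⟩, ⟨-b, 0, ?_⟩, ⟨a * b, -c - a * b, ?_⟩⟩, rfl, ?_⟩
  · push_cast; ring
  · push_cast; ring
  · push_cast; ring
  · simp only [Function.iterate_succ, Function.iterate_zero, Function.comp, id, rho, Hmul, h4, h5,
      Prod.mk.injEq]
    refine ⟨?_, ?_, ?_⟩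
    · linear_combination (a : ℂ) / 3 * (zeta + 2) * h2
    · linear_combination (b : ℂ) / 3 * (zeta + 2) * h2
    · have e : (1 - zeta) * (1 - zeta) = -zeta := by linear_combination h2
      have f : (1 + zeta) ^ 2 = 3 * zeta := by linear_combination h2
      rw [f, ← mul_assoc, e]
      linear_combination (-(c : ℂ) / 3 - 2 / 3 * a * b) * h2
end

section
/- The quotient topological space of the torus ℂ/Λ by the order-3 action generated by multiplication by ζ⁴ is homeomorphic to the 2-sphere S². (This is the statement that the image π̂(Σ₁) of the torus Σ₁ = {(u1,0,0)} in the orbifold M̂ = M/ℤ₆ is a 2-sphere; the quotient map ℂ/Λ → S² is a degree-3 map with three ramification points of order 3.) -/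
/-- The relation on `ℂ` generating the quotient of the torus `ℂ/Λ` by the order-3 action
generated by multiplication by `ζ⁴`: two points are related when they differ by a lattice
translation together with a power of multiplication by `ζ⁴`. -/
noncomputable def torusRel (x y : ℂ) : Prop :=
  ∃ (k : ℕ), ∃ l ∈ Lam, y = zeta ^ (4 * k) * x + l

namespace T333

open Complex

lemma zeta_eq : zeta = (1/2 : ℝ) + (Real.sqrt 3 / 2 : ℝ) * I := by
  unfold zeta
  have h : (Real.pi * I / 3 : ℂ) = ((Real.pi / 3 : ℝ) : ℂ) * I := by push_cast; ring
  rw [h, exp_mul_I, ← ofReal_cos, ← ofReal_sin, Real.cos_pi_div_three, Real.sin_pi_div_three]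

lemma zeta_re : zeta.re = 1/2 := by rw [zeta_eq]; simp
lemma zeta_im : zeta.im = Real.sqrt 3 / 2 := by rw [zeta_eq]; simp

lemma zeta_sq : zeta ^ 2 = zeta - 1 := by
  have h3 : Real.sqrt 3 * Real.sqrt 3 = 3 := Real.mul_self_sqrt (by norm_num)
  apply Complex.ext
  · simp [pow_two, zeta_re, zeta_im]; nlinarith
  · simp [pow_two, zeta_re, zeta_im]; ring

lemma zeta_four : zeta ^ 4 = - zeta := by
  have h := zeta_sq
  linear_combination (zeta ^ 2 + zeta) * h

noncomputable def cb (z : ℂ) : ℝ := z.im / (Real.sqrt 3 / 2)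
noncomputable def ca (z : ℂ) : ℝ := z.re - cb z / 2

lemma c_spec (z : ℂ) : z = (ca z : ℂ) + (cb z : ℂ) * zeta := by
  have h3 : Real.sqrt 3 ≠ 0 := by positivity
  apply Complex.ext
  · simp [zeta_re, ca]; ring
  · rw [add_im, ofReal_im, im_ofReal_mul, zeta_im, cb]; field_simp; simp

lemma ca_mk (a b : ℝ) : ca ((a : ℂ) + b * zeta) = a := by
  have h3 : Real.sqrt 3 ≠ 0 := by positivity
  simp [ca, cb, zeta_re, zeta_im]; field_simp
  try ring

lemma cb_mk (a b : ℝ) : cb ((a : ℂ) + b * zeta) = b := by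
  have h3 : Real.sqrt 3 ≠ 0 := by positivity
  simp [cb, zeta_re, zeta_im]

lemma continuous_cb : Continuous cb := by unfold cb; fun_prop
lemma continuous_ca : Continuous ca := by
  have := continuous_cb
  unfold ca; fun_prop

noncomputable def E (t : ℝ) : ℂ := exp (2 * Real.pi * t * I)

lemma continuous_E : Continuous E := by unfold E; fun_prop

lemma E_add (s t : ℝ) : E (s + t) = E s * E t := by
  unfold E; rw [← exp_add]; congr 1; push_cast; ring

lemma E_int (n : ℤ) : E n = 1 := by
  unfold E; rw [Complex.exp_eq_one_iff]; exact ⟨n, by push_cast; ring⟩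

lemma E_zero : E 0 = 1 := by simp [E]

lemma E_eq_iff (s t : ℝ) : E s = E t ↔ ∃ n : ℤ, s = t + n := by
  unfold E; rw [Complex.exp_eq_exp_iff_exists_int]
  have hpi : (Real.pi : ℂ) ≠ 0 := by exact_mod_cast Real.pi_ne_zero
  refine exists_congr fun n => ?_
  constructor
  · intro h
    have : (2 * Real.pi * I : ℂ) * s = (2 * Real.pi * I) * (t + n) := by linear_combination h
    have := mul_left_cancel₀ (by simp [hpi, I_ne_zero]) this
    exact_mod_cast this
  · rintro rfl; push_cast; ring

lemma E_conj (t : ℝ) : (starRingEnd ℂ) (E t) = E (-t) := by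
  unfold E; rw [← exp_conj]; congr 1; simp [Complex.conj_ofNat]

lemma E_mul_conj (t : ℝ) : E t * (starRingEnd ℂ) (E t) = 1 := by
  rw [E_conj, ← E_add]; simp [E_zero]

lemma exists_E (u : ℂ) (hu : u * (starRingEnd ℂ) u = 1) : ∃ t : ℝ, E t = u := by
  have hn : ‖u‖ = 1 := by
    rw [mul_conj] at hu
    have h : normSq u = 1 := by exact_mod_cast hu
    rw [normSq_eq_norm_sq] at h
    nlinarith [norm_nonneg u]
  refine ⟨arg u / (2 * Real.pi), ?_⟩
  have hpi : (Real.pi : ℂ) ≠ 0 := by exact_mod_cast Real.pi_ne_zero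
  have h := norm_mul_exp_arg_mul_I u
  rw [hn] at h
  unfold E
  rw [show (2 * Real.pi * ((arg u / (2 * Real.pi) : ℝ) : ℂ) * I : ℂ) = arg u * I by
    push_cast; field_simp]
  simpa using h

/-- trace -/
def F (x y z : ℂ) : ℂ := x + y + z
/-- Vandermonde -/
def D (x y z : ℂ) : ℂ := (x - y) * (y - z) * (z - x)

noncomputable def FF (w : ℂ) : ℂ := F (E (ca w)) (E (cb w)) (E (-ca w - cb w))
noncomputable def DD (w : ℂ) : ℂ := D (E (ca w)) (E (cb w)) (E (-ca w - cb w))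

lemma E_prod (a b : ℝ) : E a * E b * E (-a - b) = 1 := by
  rw [← E_add, ← E_add, ← E_zero]; congr 1; ring

/-- the defining function of the surface -/
def H (x y v : ℝ) : ℝ :=
  27 - 18 * (x^2+y^2) + 8 * (x^3 - 3*x*y^2) - (x^2+y^2)^2 - v^2

section alg
variable {x y z : ℂ}

local notation "cj" => starRingEnd ℂ

lemma e2_eq (hx : x * cj x = 1) (hy : y * cj y = 1) (hz : z * cj z = 1) (h : x * y * z = 1) :
    x * y + y * z + z * x = cj (F x y z) := by
  simp only [F, map_add]
  have h1 : cj x = y * z := by linear_combination y * z * hx - cj x * h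
  have h2 : cj y = z * x := by linear_combination z * x * hy - cj y * h
  have h3 : cj z = x * y := by linear_combination x * y * hz - cj z * h
  rw [h1, h2, h3]; ring

lemma D_conj (hx : x * cj x = 1) (hy : y * cj y = 1) (hz : z * cj z = 1) (h : x * y * z = 1) :
    cj (D x y z) = - D x y z := by
  have h1 : cj x = y * z := by linear_combination y * z * hx - cj x * h
  have h2 : cj y = z * x := by linear_combination z * x * hy - cj y * h
  have h3 : cj z = x * y := by linear_combination x * y * hz - cj z * h
  simp only [D, map_mul, map_sub, h1, h2, h3]
  linear_combination (-(x - y) * (y - z) * (z - x)) * h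

lemma D_sq (h : x * y * z = 1) (h2 : x * y + y * z + z * x = cj (F x y z)) :
    D x y z ^ 2 = -((H (F x y z).re (F x y z).im 0 : ℝ) : ℂ) := by
  have key : D x y z ^ 2 = (F x y z)^2 * (x * y + y * z + z * x)^2 - 4 * (x * y + y * z + z * x)^3
      - 4 * (F x y z)^3 * (x*y*z) + 18 * (F x y z) * (x * y + y * z + z * x) * (x*y*z)
      - 27 * (x*y*z)^2 := by
    simp only [D, F]; ring
  rw [key, h, h2]
  generalize F x y z = f
  apply Complex.ext
  · simp [H, pow_succ]; ring
  · simp [H, pow_succ]; ring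

lemma perm_cases {x' y' z' : ℂ} (h : x * y * z = 1) (h' : x' * y' * z' = 1)
    (hF : F x y z = F x' y' z') (h2 : x * y + y * z + z * x = x' * y' + y' * z' + z' * x')
    (hD : D x y z = D x' y' z') :
    (x' = x ∧ y' = y ∧ z' = z) ∨ (x' = y ∧ y' = z ∧ z' = x) ∨ (x' = z ∧ y' = x ∧ z' = y) := by
  simp only [F] at hF
  have two : ∀ p q p' q' : ℂ, p + q = p' + q' → p * q = p' * q' →
      (p' = p ∧ q' = q) ∨ (p' = q ∧ q' = p) := by
    intro p q p' q' hs hp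
    have : (p' - p) * (p' - q) = 0 := by linear_combination (-p') * hs + hp
    rcases mul_eq_zero.mp this with h | h
    · left; exact ⟨by linear_combination h, by linear_combination -h - hs⟩
    · right; exact ⟨by linear_combination h, by linear_combination -h - hs⟩
  have deg : D x y z = - D x y z → x = y ∨ y = z ∨ z = x := by
    intro h
    have h0 : D x y z = 0 := by linear_combination h / 2
    simp only [D, mul_eq_zero, sub_eq_zero] at h0
    tauto
  have hr : (x' - x) * ((x' - y) * (x' - z)) = 0 := by
    linear_combination (-x'^2) * hF + x' * h2 - h + h'
  have hx0 : x' ≠ 0 := by rintro rfl; simp at h'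
  rcases mul_eq_zero.mp hr with hr | hr
  · have e : x' = x := by linear_combination hr
    subst e
    have hp : y * z = y' * z' := mul_left_cancel₀ hx0 (by linear_combination h - h')
    rcases two y z y' z' (by linear_combination hF) hp with ⟨rfl, rfl⟩ | ⟨rfl, rfl⟩
    · simp
    · rcases deg (by nth_rewrite 1 [hD]; simp only [D]; ring) with rfl | rfl | rfl <;> simp
  rcases mul_eq_zero.mp hr with hr | hr
  · have e : x' = y := by linear_combination hr
    subst e
    have hp : x * z = y' * z' := mul_left_cancel₀ hx0 (by linear_combination h - h')
    rcases two x z y' z' (by linear_combination hF) hp with ⟨rfl, rfl⟩ | ⟨rfl, rfl⟩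
    · rcases deg (by nth_rewrite 1 [hD]; simp only [D]; ring) with rfl | rfl | rfl <;> simp
    · simp
  · have e : x' = z := by linear_combination hr
    subst e
    have hp : x * y = y' * z' := mul_left_cancel₀ hx0 (by linear_combination h - h')
    rcases two x y y' z' (by linear_combination hF) hp with ⟨rfl, rfl⟩ | ⟨rfl, rfl⟩
    · simp
    · rcases deg (by nth_rewrite 1 [hD]; simp only [D]; ring) with rfl | rfl | rfl <;> simp

/-- if a pair of roots is swapped by the inversion `t ↦ 1 / conj t`, the discriminant is positive -/
lemma unimod_aux {p q : ℂ} (h : x * p * q = 1) (hp : p * cj x = 1) (hne : p ≠ x)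
    (r : ℝ) (hr : 0 ≤ r) (hD : D x p q ^ 2 = -(r : ℂ)) : False := by
  have hx0 : x ≠ 0 := by rintro rfl; simp at h
  have hcx0 : cj x ≠ 0 := by simpa using hx0
  have hp' : cj p * x = 1 := by simpa using congrArg cj hp
  have hq : q * x = cj x := by linear_combination (cj x) * h - q * x * hp
  have hq' : cj q * cj x = x := by simpa using congrArg cj hq
  have hqq : q * cj q = 1 := by
    apply mul_left_cancel₀ (mul_ne_zero hx0 hcx0)
    linear_combination (cj q * cj x) * hq + cj x * hq'
  have hpe : p = (cj x)⁻¹ := eq_inv_of_mul_eq_one_left hp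
  have hqe : q = cj x / x := by field_simp; exact hq
  have hDr : cj (D x p q) = D x p q := by
    simp only [D, map_mul, map_sub, hpe, hqe, map_inv₀, map_div₀, conj_conj]
    field_simp
  obtain ⟨d, hd⟩ := Complex.conj_eq_iff_real.mp hDr
  rw [hd] at hD
  have : d ^ 2 = - r := by exact_mod_cast hD
  have hd0 : d = 0 := by nlinarith
  rw [hd0] at hd
  simp only [D, ofReal_zero, mul_eq_zero, sub_eq_zero] at hd
  rcases hd with (hd | hd) | hd
  · exact hne hd.symm
  · rw [← hd] at hqq
    have h1 : p * (cj p - cj x) = 0 := by linear_combination hqq - hp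
    have hp0 : p ≠ 0 := by rintro rfl; simp at h
    have := (mul_eq_zero.mp h1).resolve_left hp0
    rw [← map_sub] at this
    have : p - x = 0 := (map_eq_zero _).mp this
    exact hne (by linear_combination this)
  · rw [hd] at hqq
    apply hne
    apply mul_right_cancel₀ hcx0
    rw [hp, hqq]

lemma unimod {f : ℂ} (h : x * y * z = 1) (hF : F x y z = f)
    (h2 : x * y + y * z + z * x = cj f)
    (r : ℝ) (hr : 0 ≤ r) (hD : D x y z ^ 2 = -(r : ℂ)) : x * cj x = 1 := by
  have hx0 : x ≠ 0 := by rintro rfl; simp at h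
  have hcx0 : cj x ≠ 0 := by simpa using hx0
  by_contra hne
  have hc1 : cj x * cj y * cj z = 1 := by simpa using congrArg cj h
  have hc2 : cj x * cj y + cj y * cj z + cj z * cj x = f := by simpa using congrArg cj h2
  have hc3 : cj x + cj y + cj z = cj f := by simpa [F] using congrArg cj hF
  have hroot : (1 - x * cj x) * ((1 - y * cj x) * (1 - z * cj x)) = 0 := by
    simp only [F] at hF
    have : (cj x)^3 - cj f * (cj x)^2 + f * cj x - 1 = 0 := by
      rw [← hc3, ← hc2, ← hc1]; ring
    linear_combination (-1) * this - cj x * hF + (cj x)^2 * h2 - (cj x)^3 * h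
  rcases mul_eq_zero.mp hroot with h0 | h0
  · exact hne (by linear_combination -h0)
  rcases mul_eq_zero.mp h0 with h0 | h0
  · have hy : y * cj x = 1 := by linear_combination -h0
    refine unimod_aux (x := x) (p := y) (q := z) h hy ?_ r hr hD
    rintro rfl; exact hne hy
  · have hy : z * cj x = 1 := by linear_combination -h0
    refine unimod_aux (x := x) (p := z) (q := y) (by linear_combination h) hy ?_ r hr ?_
    · rintro rfl; exact hne hy
    · rw [← hD]; simp only [D]; ring

lemma exists_roots (f : ℂ) : ∃ x y z : ℂ, x * y * z = 1 ∧ F x y z = f ∧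
    x * y + y * z + z * x = cj f := by
  obtain ⟨x, hx⟩ : ∃ x : ℂ, x^3 - f * x^2 + cj f * x - 1 = 0 := by
    let P : Polynomial ℂ := Cubic.toPoly ⟨1, -f, cj f, -1⟩
    have hdeg : P.degree ≠ 0 := by
      rw [Cubic.degree_of_a_ne_zero (by simp)]; decide
    obtain ⟨x, hx⟩ := IsAlgClosed.exists_root P hdeg
    refine ⟨x, ?_⟩
    simp [P, Cubic.toPoly, Polynomial.IsRoot] at hx
    linear_combination hx
  have hx0 : x ≠ 0 := by rintro rfl; simp at hx
  obtain ⟨s, hs⟩ := IsAlgClosed.exists_pow_nat_eq ((f - x)^2 - 4 / x) (n := 2) (by norm_num)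
  have hp : ((f - x) + s)/2 * (((f - x) - s)/2) = 1 / x := by
    linear_combination (-1/4) * hs
  have hp' : x * (((f - x) + s)/2 * (((f - x) - s)/2)) = 1 := by
    rw [hp]; field_simp
  refine ⟨x, ((f - x) + s)/2, ((f - x) - s)/2, ?_, ?_, ?_⟩
  · linear_combination hp'
  · simp only [F]; ring
  · apply mul_left_cancel₀ hx0
    linear_combination hp' - hx

lemma exists_point (f : ℂ) (v : ℝ) (h : H f.re f.im v = 0) :
    ∃ w : ℂ, FF w = f ∧ DD w = v * I := by
  have main : ∃ x y z : ℂ, x * y * z = 1 ∧ F x y z = f ∧ D x y z = v * I ∧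
      x * cj x = 1 ∧ y * cj y = 1 := by
    obtain ⟨x, y, z, h1, h2, h3⟩ := exists_roots f
    have hD : D x y z ^ 2 = -((v^2 : ℝ) : ℂ) := by
      rw [D_sq h1 (by rw [h2, h3]), h2]
      congr 2
      unfold H at h ⊢; linarith
    have hx := unimod h1 h2 h3 _ (sq_nonneg v) hD
    have hy : y * cj y = 1 := unimod (x := y) (y := z) (z := x) (f := f) (by linear_combination h1)
      (by simp only [F] at h2 ⊢; linear_combination h2) (by linear_combination h3) _ (sq_nonneg v)
      (by rw [← hD]; simp only [D]; ring)
    have hc : (D x y z - v * I) * (D x y z + v * I) = 0 := by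
      push_cast at hD
      linear_combination hD - v^2 * I_sq
    rcases mul_eq_zero.mp hc with hc | hc
    · exact ⟨x, y, z, h1, h2, by linear_combination hc, hx, hy⟩
    · refine ⟨y, x, z, by linear_combination h1, ?_, ?_, hy, hx⟩
      · simp only [F] at h2 ⊢; linear_combination h2
      · simp only [D] at hc ⊢; linear_combination -hc
  obtain ⟨x, y, z, h1, h2, h3, hx, hy⟩ := main
  obtain ⟨a, rfl⟩ := exists_E x hx
  obtain ⟨b, rfl⟩ := exists_E y hy
  have hz : E (-a - b) = z := by
    have := E_prod a b
    have h0 : E a * E b ≠ 0 := by intro h0; rw [h0] at h1; simp at h1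
    exact mul_left_cancel₀ h0 (by rw [this, h1])
  refine ⟨(a : ℂ) + b * zeta, ?_, ?_⟩
  · rw [FF, ca_mk, cb_mk, hz, h2]
  · rw [DD, ca_mk, cb_mk, hz, h3]

end alg

lemma DD_re (w : ℂ) : (DD w).re = 0 := by
  have h := D_conj (E_mul_conj (ca w)) (E_mul_conj (cb w)) (E_mul_conj (-ca w - cb w)) (E_prod _ _)
  have := congrArg Complex.re h
  simp only [conj_re, neg_re] at this
  unfold DD; linarith

lemma H_zero (w : ℂ) : H (FF w).re (FF w).im (DD w).im = 0 := by
  have h := D_sq (E_prod (ca w) (cb w)) (e2_eq (E_mul_conj (ca w)) (E_mul_conj (cb w))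
    (E_mul_conj (-ca w - cb w)) (E_prod _ _))
  change DD w ^ 2 = -((H (FF w).re (FF w).im 0 : ℝ) : ℂ) at h
  have h' := congrArg Complex.re h
  simp only [pow_two, mul_re, DD_re, neg_re, ofReal_re] at h'
  unfold H at h' ⊢
  linarith

/-- invariance and separation -/
lemma torusRel_iff (w w' : ℂ) : (FF w = FF w' ∧ DD w = DD w') ↔ torusRel w w' := by
  have lift : ∀ (a b a' b' : ℝ), E a' = E a → E b' = E b →
      ((a' : ℂ) + b' * zeta) - ((a : ℂ) + b * zeta) ∈ Lam := by
    intro a b a' b' h1 h2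
    obtain ⟨m, rfl⟩ := (E_eq_iff _ _).mp h1
    obtain ⟨n, rfl⟩ := (E_eq_iff _ _).mp h2
    exact ⟨m, n, by push_cast; ring⟩
  have rot : ∀ a b : ℝ, zeta ^ 4 * ((a : ℂ) + b * zeta) = (b : ℝ) + ((-a - b : ℝ) : ℂ) * zeta := by
    intro a b
    rw [zeta_four]; push_cast; linear_combination (-(b : ℂ)) * zeta_sq
  constructor
  · rintro ⟨hF, hD⟩
    have e := e2_eq (E_mul_conj (ca w)) (E_mul_conj (cb w)) (E_mul_conj (-ca w - cb w)) (E_prod _ _)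
    have e' := e2_eq (E_mul_conj (ca w')) (E_mul_conj (cb w')) (E_mul_conj (-ca w' - cb w')) (E_prod _ _)
    have key := perm_cases (E_prod (ca w) (cb w)) (E_prod (ca w') (cb w')) hF
      (by rw [e, e']; exact congrArg _ hF) hD
    rcases key with ⟨h1, h2, -⟩ | ⟨h1, h2, -⟩ | ⟨h1, h2, -⟩
    · refine ⟨0, _, lift _ _ _ _ h1 h2, ?_⟩
      rw [← c_spec, ← c_spec]; simp
    · refine ⟨1, _, lift _ _ _ _ h1 h2, ?_⟩
      rw [← rot, ← c_spec, ← c_spec]; simp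
    · refine ⟨2, _, lift _ _ (ca w') (cb w') h1 h2, ?_⟩
      have r2 := rot (cb w) (-ca w - cb w)
      rw [← rot, ← c_spec] at r2
      rw [show (-cb w - (-ca w - cb w)) = ca w by ring] at r2
      rw [← r2, ← c_spec]; ring
  · rintro ⟨k, l, ⟨m, n, rfl⟩, rfl⟩
    have step1 : ∀ w : ℂ, FF (zeta ^ 4 * w) = FF w ∧ DD (zeta ^ 4 * w) = DD w := by
      intro w
      have h := rot (ca w) (cb w)
      rw [← c_spec] at h
      rw [h]
      unfold FF DD
      rw [ca_mk, cb_mk, show (-cb w - (-ca w - cb w)) = ca w by ring]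
      constructor
      · simp only [F]; ring
      · simp only [D]; ring
    have step2 : ∀ w : ℂ, FF (w + (m + n * zeta)) = FF w ∧ DD (w + (m + n * zeta)) = DD w := by
      intro w
      have h : w + (m + n * zeta) = ((ca w + m : ℝ) : ℂ) + ((cb w + n : ℝ) : ℂ) * zeta := by
        conv_lhs => rw [c_spec w]
        push_cast; ring
      rw [h]
      unfold FF DD
      have e1 : E (ca w + m) = E (ca w) := (E_eq_iff _ _).mpr ⟨m, rfl⟩
      have e2 : E (cb w + n) = E (cb w) := (E_eq_iff _ _).mpr ⟨n, rfl⟩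
      have e3 : E (-(ca w + m) - (cb w + n)) = E (-ca w - cb w) :=
        (E_eq_iff _ _).mpr ⟨-m - n, by push_cast; ring⟩
      rw [ca_mk, cb_mk, e1, e2, e3]; exact ⟨rfl, rfl⟩
    have step3 : ∀ k : ℕ, FF (zeta ^ (4 * k) * w) = FF w ∧ DD (zeta ^ (4 * k) * w) = DD w := by
      intro k
      induction k with
      | zero => simp
      | succ k ih =>
        have : zeta ^ (4 * (k+1)) * w = zeta ^ 4 * (zeta ^ (4 * k) * w) := by ring
        rw [this, (step1 _).1, (step1 _).2]; exact ih
    rw [(step2 _).1, (step2 _).2, (step3 k).1, (step3 k).2]; exact ⟨rfl, rfl⟩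

lemma cube_le (x y : ℝ) : x^3 - 3*x*y^2 ≤ Real.sqrt (x^2+y^2) ^ 3 := by
  have h := Real.sq_sqrt (show 0 ≤ x^2+y^2 by positivity)
  apply le_of_abs_le
  apply abs_le_of_sq_le_sq _ (by positivity)
  rw [show (Real.sqrt (x^2+y^2) ^ 3)^2 = (Real.sqrt (x^2+y^2) ^ 2)^3 by ring, h]
  nlinarith [sq_nonneg (3*x^2*y-y^3)]

lemma ray_unique (x y v r : ℝ) (hr : 0 < r) (h : H x y v = 0) (h' : H (r*x) (r*y) (r*v) = 0) :
    r = 1 := by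
  by_contra hne
  have hc := cube_le x y
  have hs := Real.sq_sqrt (show 0 ≤ x^2+y^2 by positivity)
  have hs0 := Real.sqrt_nonneg (x^2+y^2)
  set ρ := Real.sqrt (x^2+y^2) with hρ
  set c := x^3 - 3*x*y^2 with hcd
  have e1 : 27 - 18 * ρ^2 + 8 * c - ρ^4 - v^2 = 0 := by
    rw [← h]; unfold H; rw [show ρ^4 = (ρ^2)^2 by ring, hs]
  have e2 : 27 - 18 * r^2 * ρ^2 + 8 * r^3 * c - r^4 * ρ^4 - r^2 * v^2 = 0 := by
    rw [← h', hcd]; unfold H; rw [show ρ^4 = (ρ^2)^2 by ring, hs]; ring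
  have e3 : (r+1) * (18 * ρ^2 + v^2) - 8 * (r^2+r+1) * c + (r+1)*(r^2+1)*ρ^4 = 0 := by
    apply mul_left_cancel₀ (sub_ne_zero.mpr hne)
    linear_combination e1 - e2
  have e4 : 8 * (r^2+r+1) * c ≤ 8 * (r^2+r+1) * ρ^3 := by gcongr
  have hpos : 0 < 18 * (r+1) - 8 * (r^2+r+1) * ρ + (r+1)*(r^2+1)*ρ^2 := by
    have hq : 0 < (r-1)^2 * (r^2+4*r+1) := by
      have : r - 1 ≠ 0 := sub_ne_zero.mpr hne
      positivity
    have hA : 0 < (r+1)*(r^2+1) := by positivity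
    have : 0 < (r+1)*(r^2+1) * (18 * (r+1) - 8 * (r^2+r+1) * ρ + (r+1)*(r^2+1)*ρ^2) := by
      nlinarith [sq_nonneg ((r+1)*(r^2+1)*ρ - 4 * (r^2+r+1))]
    exact pos_of_mul_pos_right this hA.le
  have e5 : ρ^2 * (18 * (r+1) - 8 * (r^2+r+1) * ρ + (r+1)*(r^2+1)*ρ^2) + (r+1) * v^2 ≤ 0 := by
    nlinarith
  have h1 : 0 ≤ (r+1) * v^2 := by positivity
  have h2 : ρ^2 = 0 := by
    by_contra h0
    have : 0 < ρ^2 := lt_of_le_of_ne (sq_nonneg _) (Ne.symm h0)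
    nlinarith [mul_pos this hpos]
  rw [h2] at e5
  have h3 : v^2 = 0 := by nlinarith [sq_nonneg v]
  have h4 : ρ = 0 := by simpa using h2
  have hx : x = 0 := by nlinarith [sq_nonneg x, sq_nonneg y]
  have hc0 : c = 0 := by rw [hcd, hx]; ring
  rw [h4, hc0, h3] at e1
  norm_num at e1

lemma ray_exists (x y v : ℝ) (h1 : x^2+y^2+v^2 = 1) : ∃ r : ℝ, 0 < r ∧ H (r*x) (r*y) (r*v) = 0 := by
  have hcont : Continuous fun r : ℝ => H (r*x) (r*y) (r*v) := by unfold H; fun_prop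
  have h6 : H (6*x) (6*y) (6*v) ≤ 0 := by
    have hc := cube_le x y
    have hs := Real.sq_sqrt (show 0 ≤ x^2+y^2 by positivity)
    set ρ := Real.sqrt (x^2+y^2) with hρ
    have : H (6*x) (6*y) (6*v) =
      27 - 18 * 36 * ρ^2 + 8 * 216 * (x^3 - 3*x*y^2) - 1296 * (ρ^2)^2 - 36 * v^2 := by
      unfold H; rw [hs]; ring
    nlinarith [mul_nonneg (sq_nonneg ρ) (sq_nonneg (6*ρ-4)), sq_nonneg v, sq_nonneg ρ]
  have h0 : 0 ≤ H (0*x) (0*y) (0*v) := by norm_num [H]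
  obtain ⟨r, hr, hr'⟩ := intermediate_value_Icc' (show (0:ℝ) ≤ 6 by norm_num) hcont.continuousOn
    ⟨h6, h0⟩
  refine ⟨r, lt_of_le_of_ne hr.1 ?_, hr'⟩
  rintro rfl
  norm_num [H] at hr'

noncomputable def G (w : ℂ) : EuclideanSpace ℝ (Fin 3) := !₂[(FF w).re, (FF w).im, (DD w).im]

lemma continuous_G : Continuous G := by
  have := continuous_ca
  have := continuous_cb
  have := continuous_E
  have hF : Continuous FF := by unfold FF F; fun_prop
  have hD : Continuous DD := by unfold DD D; fun_prop
  unfold G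
  refine (PiLp.continuous_toLp 2 _).comp (continuous_pi fun i => ?_)
  fin_cases i
  · exact continuous_re.comp hF
  · exact continuous_im.comp hF
  · exact continuous_im.comp hD

lemma G_ne (w : ℂ) : G w ≠ 0 := by
  intro h
  have h0 : (FF w).re = 0 := by simpa [G] using congrArg (fun v => v 0) h
  have h1 : (FF w).im = 0 := by simpa [G] using congrArg (fun v => v 1) h
  have h2 : (DD w).im = 0 := by simpa [G] using congrArg (fun v => v 2) h
  have := H_zero w
  rw [h0, h1, h2] at this
  norm_num [H] at this

noncomputable def S (w : ℂ) : Metric.sphere (0 : EuclideanSpace ℝ (Fin 3)) 1 :=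
  ⟨‖G w‖⁻¹ • G w, by simp [norm_smul, G_ne w]⟩

lemma continuous_S : Continuous S := by
  refine Continuous.subtype_mk ?_ _
  exact (continuous_G.norm.inv₀ fun w => norm_ne_zero_iff.mpr (G_ne w)).smul continuous_G

lemma G_scale (w w' : ℂ) (r : ℝ) (hr : 0 < r) (h : G w' = r • G w) : G w' = G w := by
  have h0 : (FF w').re = r * (FF w).re := by simpa [G] using congrArg (fun v => v 0) h
  have h1 : (FF w').im = r * (FF w).im := by simpa [G] using congrArg (fun v => v 1) h
  have h2 : (DD w').im = r * (DD w).im := by simpa [G] using congrArg (fun v => v 2) h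
  have h' := H_zero w'
  rw [h0, h1, h2] at h'
  have := ray_unique _ _ _ r hr (H_zero w) h'
  rw [h, this, one_smul]

lemma S_eq_iff (w w' : ℂ) : S w = S w' ↔ torusRel w w' := by
  rw [← torusRel_iff]
  constructor
  · intro h
    have h := congrArg Subtype.val h
    simp only [S] at h
    have n1 : 0 < ‖G w‖ := norm_pos_iff.mpr (G_ne w)
    have n2 : 0 < ‖G w'‖ := norm_pos_iff.mpr (G_ne w')
    have hG : G w' = G w := by
      apply G_scale w w' (‖G w'‖ * ‖G w‖⁻¹) (by positivity)
      rw [mul_smul, h, smul_smul, mul_inv_cancel₀ n2.ne', one_smul]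
    have h0 : (FF w').re = (FF w).re := by simpa [G] using congrArg (fun v => v 0) hG
    have h1 : (FF w').im = (FF w).im := by simpa [G] using congrArg (fun v => v 1) hG
    have h2 : (DD w').im = (DD w).im := by simpa [G] using congrArg (fun v => v 2) hG
    exact ⟨Complex.ext h0.symm h1.symm, Complex.ext (by rw [DD_re, DD_re]) h2.symm⟩
  · rintro ⟨h1, h2⟩
    have : G w = G w' := by simp only [G, h1, h2]
    simp only [S, this]

lemma S_surj : Function.Surjective S := by
  rintro ⟨p, hp⟩
  have hn : ‖p‖ = 1 := by simpa using hp
  have h1 : (p 0)^2 + (p 1)^2 + (p 2)^2 = 1 := by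
    have := EuclideanSpace.norm_sq_eq p
    rw [hn, Fin.sum_univ_three] at this
    simp only [Real.norm_eq_abs, sq_abs] at this
    linarith
  obtain ⟨r, hr, hH⟩ := ray_exists _ _ _ h1
  obtain ⟨w, hF, hD⟩ := exists_point ⟨r * p 0, r * p 1⟩ (r * p 2) hH
  have hG : G w = r • p := by
    ext i
    fin_cases i <;> simp [G, hF, hD]
  refine ⟨w, Subtype.ext ?_⟩
  simp only [S, hG, norm_smul, hn, Real.norm_eq_abs, abs_of_pos hr, mul_one]
  rw [smul_smul, inv_mul_cancel₀ hr.ne', one_smul]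

lemma compact_quot : CompactSpace (Quot torusRel) := by
  let g : ℝ × ℝ → Quot torusRel := fun p => Quot.mk _ ((p.1 : ℂ) + p.2 * zeta)
  have hg : Continuous g := continuous_quot_mk.comp (by fun_prop)
  have hc : IsCompact (g '' (Set.Icc 0 1 ×ˢ Set.Icc 0 1)) :=
    (isCompact_Icc.prod isCompact_Icc).image hg
  refine ⟨?_⟩
  convert hc
  symm
  rw [Set.eq_univ_iff_forall]
  intro q
  induction q using Quot.ind with
  | _ w =>
  refine ⟨(Int.fract (ca w), Int.fract (cb w)),
    ⟨⟨Int.fract_nonneg _, (Int.fract_lt_one _).le⟩, ⟨Int.fract_nonneg _, (Int.fract_lt_one _).le⟩⟩, ?_⟩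
  apply Quot.sound
  refine ⟨0, _, ⟨⌊ca w⌋, ⌊cb w⌋, rfl⟩, ?_⟩
  conv_lhs => rw [c_spec w, ← Int.fract_add_floor (ca w), ← Int.fract_add_floor (cb w)]
  push_cast; ring

end T333

/-- The quotient of the torus `ℂ/Λ` by the order-3 action generated by multiplication by
`ζ⁴` is homeomorphic to the 2-sphere `S² ⊂ ℝ³`: the image `π̂(Σ₁)` of the torus
`Σ₁ = {(u1,0,0)}` in the orbifold `M̂ = M/ℤ₆` is a 2-sphere. -/
theorem stmt18 :
    Nonempty (Quot torusRel ≃ₜ Metric.sphere (0 : EuclideanSpace ℝ (Fin 3)) 1) := by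
  have := T333.compact_quot
  let f : Quot torusRel → Metric.sphere (0 : EuclideanSpace ℝ (Fin 3)) 1 :=
    Quot.lift T333.S fun a b h => (T333.S_eq_iff a b).mpr h
  have hf : Continuous f := continuous_quot_lift _ T333.continuous_S
  have hb : Function.Bijective f := by
    constructor
    · intro p q
      induction p using Quot.ind with
      | _ a =>
      induction q using Quot.ind with
      | _ b =>
      intro h
      exact Quot.sound ((T333.S_eq_iff a b).mp h)
    · intro p
      obtain ⟨w, hw⟩ := T333.S_surj p
      exact ⟨Quot.mk _ w, hw⟩
  exact ⟨Continuous.homeoOfEquivCompactToT2 (f := Equiv.ofBijective f hb) hf⟩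
end

section
/- Let G = ℂ³ with the Heisenberg product, Γ = {(u1,u2,u3) : u1,u2,u3 ∈ Λ}, and let M = Γ\G be the quotient topological space of G by the left-translation action of Γ. The map ρ(u1,u2,u3) = (ζ⁴·u1, ζ·u2, ζ⁵·u3) descends to a homeomorphism of M generating an action of ℤ₆. Then the quotient topological space M̂ = M/ℤ₆ is simply connected (it is path-connected and has trivial fundamental group). -/
/-- The relation on `G = ℂ³` whose generated equivalence identifies the orbits of the
group generated by left translations by `Γ` and by `ρ`; its quotient is the orbifold
`M̂ = M/ℤ₆ = (Γ\G)/⟨ρ⟩` with the quotient topology. -/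
noncomputable def nilRel (x y : ℂ × ℂ × ℂ) : Prop :=
  (∃ γ ∈ Gam, y = Hmul γ x) ∨ y = rho x

open Topology

namespace NilOrb

abbrev E := ℂ × ℂ × ℂ

/-! ### The lattice -/

lemma zeta_sq : zeta ^ 2 = zeta - 1 := by
  have h : zeta = (1 / 2 : ℂ) + (Real.sqrt 3 / 2 : ℝ) * Complex.I := by
    unfold zeta
    have : (Real.pi * Complex.I / 3 : ℂ) = ((Real.pi / 3 : ℝ) : ℂ) * Complex.I := by
      push_cast; ring
    rw [this, Complex.exp_mul_I, ← Complex.ofReal_cos, ← Complex.ofReal_sin,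
      Real.cos_pi_div_three, Real.sin_pi_div_three]
    push_cast; ring
  have h3 : ((Real.sqrt 3 : ℝ) : ℂ) ^ 2 = 3 := by
    rw [← Complex.ofReal_pow, Real.sq_sqrt (by norm_num)]; norm_num
  rw [h]
  push_cast
  have hI := Complex.I_sq
  linear_combination (1 / 4 : ℂ) * Complex.I ^ 2 * h3 + (3 / 4 : ℂ) * hI

lemma zeta_six : zeta ^ 6 = 1 := by
  have h := zeta_sq
  have h3 : zeta ^ 3 = -1 := by linear_combination (zeta + 1) * h
  calc zeta ^ 6 = (zeta ^ 3) ^ 2 := by ring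
    _ = 1 := by rw [h3]; norm_num

lemma Lam_zero : (0 : ℂ) ∈ Lam := ⟨0, 0, by simp⟩
lemma Lam_one : (1 : ℂ) ∈ Lam := ⟨1, 0, by simp⟩
lemma Lam_zeta : zeta ∈ Lam := ⟨0, 1, by simp⟩
lemma Lam_add {z w : ℂ} (hz : z ∈ Lam) (hw : w ∈ Lam) : z + w ∈ Lam := by
  obtain ⟨a, b, rfl⟩ := hz
  obtain ⟨c, d, rfl⟩ := hw
  exact ⟨a + c, b + d, by push_cast; ring⟩
lemma Lam_neg {z : ℂ} (hz : z ∈ Lam) : -z ∈ Lam := by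
  obtain ⟨a, b, rfl⟩ := hz
  exact ⟨-a, -b, by push_cast; ring⟩
lemma Lam_mul {z w : ℂ} (hz : z ∈ Lam) (hw : w ∈ Lam) : z * w ∈ Lam := by
  obtain ⟨a, b, rfl⟩ := hz
  obtain ⟨c, d, rfl⟩ := hw
  refine ⟨a * c - b * d, a * d + b * c + b * d, ?_⟩
  push_cast
  linear_combination (b * d : ℂ) * zeta_sq
lemma Lam_pow {z : ℂ} (hz : z ∈ Lam) (n : ℕ) : z ^ n ∈ Lam := by
  induction n with
  | zero => simpa using Lam_one
  | succ n ih => rw [pow_succ]; exact Lam_mul ih hz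

lemma zeta_re : zeta.re = 1 / 2 := by
  unfold zeta
  have : (Real.pi * Complex.I / 3 : ℂ) = ((Real.pi / 3 : ℝ) : ℂ) * Complex.I := by
    push_cast; ring
  rw [this, Complex.exp_ofReal_mul_I_re, Real.cos_pi_div_three]

lemma zeta_im : zeta.im = Real.sqrt 3 / 2 := by
  unfold zeta
  have : (Real.pi * Complex.I / 3 : ℂ) = ((Real.pi / 3 : ℝ) : ℂ) * Complex.I := by
    push_cast; ring
  rw [this, Complex.exp_ofReal_mul_I_im, Real.sin_pi_div_three]

lemma Lam_small {z : ℂ} (hz : z ∈ Lam) (h : ‖z‖ < 1) : z = 0 := by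
  obtain ⟨a, b, rfl⟩ := hz
  have h2 : ‖(a : ℂ) + b * zeta‖ ^ 2 = ((a ^ 2 + a * b + b ^ 2 : ℤ) : ℝ) := by
    rw [Complex.sq_norm, Complex.normSq_apply]
    simp [zeta_re, zeta_im]
    have := Real.sq_sqrt (show (0 : ℝ) ≤ 3 by norm_num)
    linear_combination (b ^ 2 / 4 : ℝ) * this
  have h3 : ‖(a : ℂ) + b * zeta‖ ^ 2 < 1 := by
    have := norm_nonneg ((a : ℂ) + b * zeta)
    nlinarith
  rw [h2] at h3
  have h4 : a ^ 2 + a * b + b ^ 2 < 1 := by exact_mod_cast h3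
  have hb : b = 0 := by
    by_contra hb
    have : 0 < b ^ 2 := by positivity
    nlinarith [sq_nonneg (2 * a + b)]
  subst hb
  have ha : a = 0 := by
    by_contra ha
    have : 0 < a ^ 2 := by positivity
    nlinarith
  subst ha
  simp

lemma Lam_discrete (c : ℂ) : ∀ᶠ z in 𝓝 c, z ∈ Lam → z = c := by
  by_cases h : ∃ w ∈ Lam, ‖w - c‖ < 1 / 2
  · obtain ⟨w, hw, hwc⟩ := h
    have h1 : ∀ᶠ z in 𝓝 c, ‖z - c‖ < 1 / 2 := by
      have := Metric.ball_mem_nhds c (show (0 : ℝ) < 1 / 2 by norm_num)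
      filter_upwards [this] with z hz
      simpa [dist_eq_norm] using hz
    have key : ∀ z ∈ Lam, ‖z - c‖ < 1 / 2 → z = w := by
      intro z hz hzc
      have : z + -w = 0 := by
        apply Lam_small (Lam_add hz (Lam_neg hw))
        have : z + -w = (z - c) - (w - c) := by ring
        rw [this]
        have := norm_sub_le (z - c) (w - c)
        linarith
      linear_combination this
    by_cases hc : w = c
    · subst hc
      filter_upwards [h1] with z hz hzL
      exact key z hzL hz
    · have h2 : ∀ᶠ z in 𝓝 c, z ≠ w := isOpen_ne.mem_nhds (Ne.symm hc)
      filter_upwards [h1, h2] with z hz hzw hzL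
      exact absurd (key z hzL hz) hzw
  · push Not at h
    have h1 : ∀ᶠ z in 𝓝 c, ‖z - c‖ < 1 / 2 := by
      have := Metric.ball_mem_nhds c (show (0 : ℝ) < 1 / 2 by norm_num)
      filter_upwards [this] with z hz
      simpa [dist_eq_norm] using hz
    filter_upwards [h1] with z hz hzL
    exact absurd hz (not_lt.2 (h z hzL))

/-! ### The group action -/

noncomputable def rk (k : ℕ) (u : E) : E :=
  (zeta ^ (4 * k) * u.1, zeta ^ k * u.2.1, zeta ^ (5 * k) * u.2.2)

noncomputable def act (γ : E) (k : ℕ) (u : E) : E := Hmul γ (rk k u)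

lemma rho_eq (u : E) : rho u = act 0 1 u := by
  simp [rho, act, rk, Hmul]

lemma rk_mem {γ : E} (h : γ ∈ Gam) (k : ℕ) : rk k γ ∈ Gam :=
  ⟨Lam_mul (Lam_pow Lam_zeta _) h.1, Lam_mul (Lam_pow Lam_zeta _) h.2.1,
    Lam_mul (Lam_pow Lam_zeta _) h.2.2⟩

lemma Hmul_mem {γ δ : E} (h : γ ∈ Gam) (h' : δ ∈ Gam) : Hmul γ δ ∈ Gam :=
  ⟨Lam_add h.1 h'.1, Lam_add h.2.1 h'.2.1,
    Lam_add (Lam_add h.2.2 h'.2.2) (Lam_mul h.2.1 h'.1)⟩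

lemma zero_mem : (0 : E) ∈ Gam := ⟨Lam_zero, Lam_zero, Lam_zero⟩

lemma zeta_mod (k : ℕ) : zeta ^ (k % 6) = zeta ^ k := by
  conv_rhs => rw [← Nat.mod_add_div k 6, pow_add, pow_mul, zeta_six, one_pow, mul_one]

lemma rk_mod (k : ℕ) (u : E) : rk (k % 6) u = rk k u := by
  have h (m : ℕ) : zeta ^ (m * (k % 6)) = zeta ^ (m * k) := by
    rw [mul_comm, pow_mul, zeta_mod, ← pow_mul, mul_comm]
  simp only [rk, h, zeta_mod]

lemma rk_rk (k l : ℕ) (u : E) : rk k (rk l u) = rk (k + l) u := by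
  simp only [rk, mul_add, pow_add, mul_assoc]

lemma rk_zero (u : E) : rk 0 u = u := by simp [rk]

lemma rk_Hmul (k : ℕ) (p q : E) : rk k (Hmul p q) = Hmul (rk k p) (rk k q) := by
  have : zeta ^ (5 * k) = zeta ^ k * zeta ^ (4 * k) := by rw [← pow_add]; congr 1; ring
  simp only [rk, Hmul, this]
  refine Prod.ext ?_ (Prod.ext ?_ ?_) <;> simp <;> ring

lemma Hmul_assoc (p q r : E) : Hmul (Hmul p q) r = Hmul p (Hmul q r) := by
  simp only [Hmul]
  refine Prod.ext ?_ (Prod.ext ?_ ?_) <;> simp <;> ring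

noncomputable def hinv (p : E) : E := (-p.1, -p.2.1, -p.2.2 + p.2.1 * p.1)

lemma hinv_mem {γ : E} (h : γ ∈ Gam) : hinv γ ∈ Gam :=
  ⟨Lam_neg h.1, Lam_neg h.2.1, Lam_add (Lam_neg h.2.2) (Lam_mul h.2.1 h.1)⟩

lemma hinv_Hmul (p q : E) : Hmul (hinv p) (Hmul p q) = q := by
  simp only [Hmul, hinv]
  refine Prod.ext ?_ (Prod.ext ?_ ?_) <;> simp
  ring

lemma act_act (γ δ : E) (k l : ℕ) (u : E) :
    act γ k (act δ l u) = act (Hmul γ (rk k δ)) (k + l) u := by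
  simp only [act, rk_Hmul, rk_rk, Hmul_assoc]

def Rel (x y : E) : Prop := ∃ γ ∈ Gam, ∃ k : ℕ, y = act γ k x

lemma Rel.refl (x : E) : Rel x x := ⟨0, zero_mem, 0, by simp [act, rk, Hmul]⟩

lemma Rel.symm {x y : E} (h : Rel x y) : Rel y x := by
  obtain ⟨γ, hγ, k, rfl⟩ := h
  refine ⟨rk (5 * k) (hinv γ), rk_mem (hinv_mem hγ) _, 5 * k, ?_⟩
  rw [act, ← rk_Hmul, act, hinv_Hmul, rk_rk, ← rk_mod]
  have : (5 * k + k) % 6 = 0 := by omega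
  rw [this, rk_zero]

lemma Rel.trans {x y z : E} (h : Rel x y) (h' : Rel y z) : Rel x z := by
  obtain ⟨γ, hγ, k, rfl⟩ := h
  obtain ⟨δ, hδ, l, rfl⟩ := h'
  exact ⟨_, Hmul_mem hδ (rk_mem hγ l), l + k, act_act _ _ _ _ _⟩

abbrev Y := Quot nilRel

def pr : C(E, Y) := ⟨Quot.mk _, continuous_quot_mk⟩

lemma pr_surj : Function.Surjective pr := Quot.mk_surjective

lemma pr_Hmul {γ : E} (h : γ ∈ Gam) (x : E) : pr (Hmul γ x) = pr x :=
  (Quot.sound (r := nilRel) (Or.inl ⟨γ, h, rfl⟩)).symm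

lemma pr_rho (x : E) : pr (rho x) = pr x := (Quot.sound (r := nilRel) (Or.inr rfl)).symm

lemma pr_rk (k : ℕ) (x : E) : pr (rk k x) = pr x := by
  induction k with
  | zero => rw [rk_zero]
  | succ k ih =>
    have : rk (k + 1) x = rho (rk k x) := by
      rw [add_comm, ← rk_rk]; simp [rho, rk]
    rw [this, pr_rho, ih]

lemma pr_act {γ : E} (h : γ ∈ Gam) (k : ℕ) (x : E) : pr (act γ k x) = pr x := by
  rw [act, pr_Hmul h, pr_rk]

lemma pr_eq {x y : E} : pr x = pr y ↔ Rel x y := by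
  constructor
  · intro h
    replace h := Quot.eqvGen_exact h
    induction h with
    | rel x y h =>
      rcases h with ⟨γ, hγ, rfl⟩ | rfl
      · exact ⟨γ, hγ, 0, by rw [act, rk_zero]⟩
      · exact ⟨0, zero_mem, 1, rho_eq _⟩
    | refl x => exact Rel.refl x
    | symm x y _ ih => exact ih.symm
    | trans x y z _ _ ih ih' => exact ih.trans ih'
  · rintro ⟨γ, hγ, k, rfl⟩
    exact (pr_act hγ k x).symm

lemma act_cont (γ : E) (k : ℕ) : Continuous (act γ k) := by
  unfold act Hmul rk
  fun_prop

lemma pr_open : IsOpenMap pr := by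
  intro U hU
  have : IsOpen (pr ⁻¹' (pr '' U)) := by
    have : pr ⁻¹' (pr '' U) = ⋃ γ ∈ Gam, ⋃ k : ℕ, act γ k ⁻¹' U := by
      ext y
      simp only [Set.mem_preimage, Set.mem_image, Set.mem_iUnion]
      constructor
      · rintro ⟨x, hx, hxy⟩
        obtain ⟨γ, hγ, k, rfl⟩ := pr_eq.1 hxy.symm
        exact ⟨γ, hγ, k, hx⟩
      · rintro ⟨γ, hγ, k, h⟩
        exact ⟨_, h, pr_act hγ k y⟩
    rw [this]
    exact isOpen_biUnion fun γ _ => isOpen_iUnion fun k => hU.preimage (act_cont γ k)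
  exact this

lemma act_affine (γ : E) (k : ℕ) (t : ℝ) (x u : E) :
    act γ k (t • x + (1 - t) • u) = t • act γ k x + (1 - t) • act γ k u := by
  simp only [act, Hmul, rk]
  refine Prod.ext ?_ (Prod.ext ?_ ?_) <;> simp <;> ring

lemma Hmul_solve {γ v u : E} (h : u = Hmul γ v) :
    γ = (u.1 - v.1, u.2.1 - v.2.1, u.2.2 - v.2.2 - (u.2.1 - v.2.1) * v.1) := by
  subst h
  simp only [Hmul]
  refine Prod.ext ?_ (Prod.ext ?_ ?_) <;> simp
  ring

lemma rk_cont (k : ℕ) : Continuous (rk k) := by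
  unfold rk
  fun_prop

lemma disc (x : E) (k : ℕ) : ∀ᶠ p : E × E in 𝓝 (x, x), ∀ γ ∈ Gam,
    p.2 = act γ k p.1 → x = act γ k x := by
  let v : E → E := rk k
  have hv : Continuous v := rk_cont k
  have h1 : Filter.Tendsto (fun p : E × E => p.2.1 - (v p.1).1) (𝓝 (x, x)) (𝓝 (x.1 - (v x).1)) :=
    Continuous.tendsto' (by fun_prop) _ _ rfl
  have h2 : Filter.Tendsto (fun p : E × E => p.2.2.1 - (v p.1).2.1) (𝓝 (x, x))
      (𝓝 (x.2.1 - (v x).2.1)) :=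
    Continuous.tendsto' (by fun_prop) _ _ rfl
  have h3 : Filter.Tendsto (fun p : E × E => p.2.2.2 - (v p.1).2.2
      - (p.2.2.1 - (v p.1).2.1) * (v p.1).1) (𝓝 (x, x))
      (𝓝 (x.2.2 - (v x).2.2 - (x.2.1 - (v x).2.1) * (v x).1)) :=
    Continuous.tendsto' (by fun_prop) _ _ rfl
  filter_upwards [h1.eventually (Lam_discrete _), h2.eventually (Lam_discrete _),
    h3.eventually (Lam_discrete _)] with p e1 e2 e3 γ hγ hp
  have hs := Hmul_solve hp
  obtain ⟨g1, g2, g3⟩ := hγ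
  have a1 : γ.1 = p.2.1 - (v p.1).1 := congrArg (fun q : E => q.1) hs
  have a2 : γ.2.1 = p.2.2.1 - (v p.1).2.1 := congrArg (fun q : E => q.2.1) hs
  have a3 : γ.2.2 = p.2.2.2 - (v p.1).2.2 - (p.2.2.1 - (v p.1).2.1) * (v p.1).1 :=
    congrArg (fun q : E => q.2.2) hs
  have b1 := a1.trans (e1 (a1 ▸ g1))
  have b2 := a2.trans (e2 (a2 ▸ g2))
  have b3 := a3.trans (e3 (a3 ▸ g3))
  change x = Hmul γ (v x)
  simp only [Hmul, b1, b2, b3]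
  refine Prod.ext ?_ (Prod.ext ?_ ?_) <;> simp
  ring

lemma disc_ball (x : E) : ∃ r > 0, ∀ u ∈ Metric.ball x r, ∀ w ∈ Metric.ball x r,
    ∀ γ ∈ Gam, ∀ k : ℕ, w = act γ k u → x = act γ k x := by
  have h : ∀ᶠ p : E × E in 𝓝 (x, x), ∀ k ∈ Finset.range 6, ∀ γ ∈ Gam,
      p.2 = act γ k p.1 → x = act γ k x :=
    (Filter.eventually_all_finset _).2 fun k _ => disc x k
  rw [Metric.eventually_nhds_iff_ball] at h
  obtain ⟨r, hr, h⟩ := h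
  refine ⟨r, hr, fun u hu w hw γ hγ k hk => ?_⟩
  have := h (u, w) (by rw [← ball_prod_same]; exact ⟨hu, hw⟩) (k % 6)
    (Finset.mem_range.2 (Nat.mod_lt _ (by norm_num))) γ hγ (by rw [act, rk_mod]; exact hk)
  rwa [act, rk_mod] at this

/-! ### Local contractibility -/

lemma contr (x : E) : ∃ r > 0, ContractibleSpace (pr '' Metric.ball x r) := by
  obtain ⟨r, hr, h⟩ := disc_ball x
  refine ⟨r, hr, ?_⟩
  set U := Metric.ball x r with hU
  have hxU : x ∈ U := Metric.mem_ball_self hr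
  have hconv : Convex ℝ U := convex_ball x r
  let q : U → pr '' U := fun u => ⟨pr u, u, u.2, rfl⟩
  have hq : IsOpenQuotientMap q := by
    refine ⟨?_, ?_, ?_⟩
    · rintro ⟨_, u, hu, rfl⟩
      exact ⟨⟨u, hu⟩, rfl⟩
    · exact (pr.continuous.comp continuous_subtype_val).subtype_mk _
    · have : IsOpenMap (fun u : U => pr u) :=
        pr_open.comp (Metric.isOpen_ball.isOpenMap_subtype_val)
      exact this.subtype_mk _
  let K : unitInterval × U → U := fun p =>
    ⟨p.1.1 • x + (1 - p.1.1) • (p.2 : E),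
      hconv hxU p.2.2 p.1.2.1 (sub_nonneg.2 p.1.2.2) (add_sub_cancel _ _)⟩
  have hK : Continuous K := by
    refine Continuous.subtype_mk ?_ _
    fun_prop
  have hQ : IsOpenQuotientMap (Prod.map id q : unitInterval × U → unitInterval × (pr '' U)) :=
    IsOpenQuotientMap.prodMap IsOpenQuotientMap.id hq
  have hcompat : ∀ (t : unitInterval) (u w : U), q u = q w → q (K (t, u)) = q (K (t, w)) := by
    intro t u w huw
    have e : pr u = pr w := congrArg Subtype.val huw
    obtain ⟨γ, hγ, k, hk⟩ := pr_eq.1 e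
    have hx := h u u.2 w w.2 γ hγ k hk
    apply Subtype.ext
    change pr (t.1 • x + (1 - t.1) • (u : E)) = pr (t.1 • x + (1 - t.1) • (w : E))
    rw [← pr_act hγ k (t.1 • x + (1 - t.1) • (u : E)), act_affine, ← hx, ← hk]
  choose s hs using hq.surjective
  let H : unitInterval × (pr '' U) → pr '' U := fun p => q (K (p.1, s p.2))
  have hHq : ∀ t u, H (t, q u) = q (K (t, u)) := fun t u => hcompat _ _ _ (hs _)
  have hH : Continuous H := by
    rw [← hQ.continuous_comp_iff]
    have : H ∘ (Prod.map id q) = q ∘ K := by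
      ext ⟨t, u⟩ : 1
      exact hHq t u
    rw [this]
    exact hq.continuous.comp hK
  refine (contractible_iff_id_nullhomotopic _).2 ⟨q ⟨x, hxU⟩, ⟨⟨⟨H, hH⟩, ?_, ?_⟩⟩⟩
  · intro v
    obtain ⟨u, rfl⟩ := hq.surjective v
    change H (0, q u) = q u
    rw [hHq]
    congr 1
    apply Subtype.ext
    simp [K]
  · intro v
    obtain ⟨u, rfl⟩ := hq.surjective v
    change H (1, q u) = q ⟨x, hxU⟩
    rw [hHq]
    congr 1
    apply Subtype.ext
    simp [K]

/-! ### Homotopy classes of projected segments -/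

noncomputable def Ph (x y : E) : Path (pr x) (pr y) := (Path.segment x y).map pr.continuous

lemma Ph_of_path {x y : E} (p : Path x y) : (p.map pr.continuous).Homotopic (Ph x y) :=
  (SimplyConnectedSpace.paths_homotopic p (Path.segment x y)).map pr

lemma Ph_trans (x y z : E) : ((Ph x y).trans (Ph y z)).Homotopic (Ph x z) := by
  have := Ph_of_path ((Path.segment x y).trans (Path.segment y z))
  rwa [Path.map_trans] at this

lemma Ph_self (x : E) : (Ph x x).Homotopic (Path.refl (pr x)) := by
  have := Ph_of_path (Path.refl x)
  exact this.symm

section abs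
variable {X : Type*} [TopologicalSpace X] {a b c d : X}

lemma abs_trans (p : Path a b) (q : Path b c) (r : Path a c) (hr : (p.trans q).Homotopic r)
    (h : a = b) (h' : b = c) (hp : (p.cast rfl h).Homotopic (Path.refl a))
    (hq : (q.cast rfl h').Homotopic (Path.refl b)) :
    (r.cast rfl (h.trans h')).Homotopic (Path.refl a) := by
  subst h h'
  simp only [Path.cast_rfl_rfl] at *
  refine hr.symm.trans ((hp.hcomp hq).trans ?_)
  rw [Path.refl_trans_refl]

lemma abs_symm (p : Path a b) (q : Path b a) (hr : (p.trans q).Homotopic (Path.refl a))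
    (h : a = b) (hp : (p.cast rfl h).Homotopic (Path.refl a)) :
    (q.cast rfl h.symm).Homotopic (Path.refl b) := by
  subst h
  simp only [Path.cast_rfl_rfl] at *
  have h1 : ((Path.refl a).trans q).Homotopic (Path.refl a) :=
    (hp.symm.hcomp (Path.Homotopic.refl q)).trans hr
  exact (Path.Homotopic.symm ⟨Path.Homotopy.reflTrans q⟩).trans h1

lemma abs_fix (p : Path a b) (q : Path b d) (r : Path a d) (hr : (p.trans q).Homotopic r)
    (h : a = d) (hq : q.cast rfl h = p.symm) :
    (r.cast rfl h).Homotopic (Path.refl a) := by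
  subst h
  simp only [Path.cast_rfl_rfl] at *
  subst hq
  exact hr.symm.trans (Path.Homotopic.symm ⟨Path.Homotopy.reflTransSymm p⟩)

lemma abs_indep (p : Path a b) (e : Path a c) (p' : Path c d) (f : Path d b)
    (m : Path a d) (h1 : (e.trans p').Homotopic m) (h2 : (m.trans f).Homotopic p)
    (hac : a = c) (hbd : d = b)
    (he : (e.cast rfl hac).Homotopic (Path.refl a))
    (hf : (f.cast rfl hbd).Homotopic (Path.refl d)) :
    p.Homotopic (p'.cast hac hbd.symm) := by
  subst hac hbd
  simp only [Path.cast_rfl_rfl] at *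
  refine h2.symm.trans ?_
  refine ((h1.symm.hcomp (Path.Homotopic.refl f))).trans ?_
  refine ((he.hcomp (Path.Homotopic.refl p')).hcomp hf).trans ?_
  exact Path.Homotopic.trans ⟨Path.Homotopy.transRefl _⟩ ⟨Path.Homotopy.reflTrans _⟩

end abs

def Dg (x y : E) : Prop :=
  ∃ h : pr x = pr y, ((Ph x y).cast rfl h).Homotopic (Path.refl (pr x))

lemma Dg.refl (x : E) : Dg x x := ⟨rfl, Ph_self x⟩

lemma Dg.trans {x y z : E} (h : Dg x y) (h' : Dg y z) : Dg x z :=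
  ⟨h.1.trans h'.1, abs_trans _ _ _ (Ph_trans x y z) h.1 h'.1 h.2 h'.2⟩

lemma Dg.symm {x y : E} (h : Dg x y) : Dg y x :=
  ⟨h.1.symm, abs_symm _ _ ((Ph_trans x y x).trans (Ph_self x)) h.1 h.2⟩

lemma Dg_fix {γ : E} (hγ : γ ∈ Gam) (k : ℕ) (c : E) (hc : act γ k c = c) (x : E) :
    Dg x (act γ k x) := by
  have h := (pr_act hγ k x).symm
  refine ⟨h, abs_fix (Ph x c) (Ph c (act γ k x)) _ (Ph_trans _ _ _) h ?_⟩
  ext t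
  change pr (Path.segment c (act γ k x) t) = pr (Path.segment x c (unitInterval.symm t))
  rw [← pr_act hγ k (Path.segment x c (unitInterval.symm t))]
  congr 1
  rw [Path.segment_apply, Path.segment_apply, AffineMap.lineMap_apply_module,
    AffineMap.lineMap_apply_module]
  have := act_affine γ k (1 - (unitInterval.symm t : ℝ)) x c
  rw [sub_sub_cancel] at this
  rw [this, hc, unitInterval.coe_symm_eq, sub_sub_cancel, add_comm]

lemma act_one_fix (γ : E) : ∃ c, act γ 1 c = c := by
  have hz := zeta_sq
  have n1 : 1 - zeta ^ 4 ≠ 0 := by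
    intro h
    have h4 : zeta ^ 4 = -zeta := by linear_combination (zeta ^ 2 + zeta) * hz
    have : zeta = -1 := by linear_combination h + h4
    rw [this] at hz; norm_num at hz
  have n2 : 1 - zeta ≠ 0 := by
    intro h
    have : zeta = 1 := by linear_combination -h
    rw [this] at hz; norm_num at hz
  have n3 : 1 - zeta ^ 5 ≠ 0 := by
    intro h
    have h5 : zeta ^ 5 = 1 - zeta := by linear_combination (zeta ^ 3 + zeta ^ 2 - 1) * hz
    have : zeta = 0 := by linear_combination h + h5
    rw [this] at hz; norm_num at hz
  obtain ⟨g1, g2, g3⟩ := γ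
  obtain ⟨c1, h1⟩ : ∃ c1, c1 * (1 - zeta ^ 4) = g1 := ⟨g1 / (1 - zeta ^ 4), by field_simp⟩
  obtain ⟨c2, h2⟩ : ∃ c2, c2 * (1 - zeta) = g2 := ⟨g2 / (1 - zeta), by field_simp⟩
  obtain ⟨c3, h3⟩ : ∃ c3, c3 * (1 - zeta ^ 5) = g3 + g2 * (zeta ^ 4 * c1) :=
    ⟨(g3 + g2 * (zeta ^ 4 * c1)) / (1 - zeta ^ 5), by field_simp⟩
  refine ⟨(c1, c2, c3), ?_⟩
  simp only [act, Hmul, rk]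
  refine Prod.ext ?_ (Prod.ext ?_ ?_) <;> simp
  · linear_combination -h1
  · linear_combination -h2
  · linear_combination -h3

lemma Dg_of_eq {x y : E} (h : pr x = pr y) : Dg x y := by
  have h1 : ∀ γ ∈ Gam, ∀ x, Dg x (act γ 1 x) := fun γ hγ x => by
    obtain ⟨c, hc⟩ := act_one_fix γ
    exact Dg_fix hγ 1 c hc x
  replace h := Quot.eqvGen_exact h
  induction h with
  | rel x y h =>
    rcases h with ⟨γ, hγ, rfl⟩ | rfl
    · have e : rk 1 (rk 5 x) = x := by
        rw [rk_rk, ← rk_mod]; exact rk_zero x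
      have a := h1 γ hγ (rk 5 x)
      have b := h1 0 zero_mem (rk 5 x)
      have e0 : act 0 1 (rk 5 x) = x := by
        rw [act, e]; simp [Hmul]
      rw [e0] at b
      rw [act, e] at a
      exact b.symm.trans a
    · rw [rho_eq]; exact h1 0 zero_mem x
  | refl x => exact Dg.refl x
  | symm x y _ ih => exact ih.symm
  | trans x y z _ _ ih ih' => exact ih.trans ih'

lemma Ph_indep {x y x' y' : E} (hx : pr x = pr x') (hy : pr y' = pr y) :
    (Ph x y).Homotopic ((Ph x' y').cast hx hy.symm) := by
  obtain ⟨_, e⟩ := Dg_of_eq hx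
  obtain ⟨_, f⟩ := Dg_of_eq hy
  exact abs_indep (Ph x y) (Ph x x') (Ph x' y') (Ph y' y) (Ph x y') (Ph_trans _ _ _)
    (Ph_trans _ _ _) hx hy e f

def Good {a b : Y} (P : Path a b) : Prop :=
  ∀ x y (hx : a = pr x) (hy : b = pr y), P.Homotopic ((Ph x y).cast hx hy)

lemma Good.of_homotopic {x y : E} {P : Path (pr x) (pr y)} (h : P.Homotopic (Ph x y)) :
    Good P := fun _ _ hx hy => h.trans (Ph_indep hx hy.symm)

lemma Good.trans {a b c : Y} {P : Path a b} {Q : Path b c} (hP : Good P) (hQ : Good Q) :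
    Good (P.trans Q) := by
  intro x z hx hz
  obtain ⟨y, hy⟩ := pr_surj b
  subst hx hy hz
  exact ((hP x y rfl rfl).hcomp (hQ y z rfl rfl)).trans (Ph_trans x y z)

lemma Good.congr {a b : Y} {P Q : Path a b} (hP : Good P) (h : P.Homotopic Q) : Good Q :=
  fun x y hx hy => h.symm.trans (hP x y hx hy)

lemma Good.refl (a : Y) : Good (Path.refl a) := by
  obtain ⟨x, rfl⟩ := pr_surj a
  exact Good.of_homotopic (Ph_self x).symm

lemma local_good (a : Y) : ∃ V : Set Y, IsOpen V ∧ a ∈ V ∧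
    ∀ (b c : Y) (P : Path b c), Set.range P ⊆ V → Good P := by
  obtain ⟨x, rfl⟩ := pr_surj a
  obtain ⟨r, hr, hc⟩ := contr x
  refine ⟨pr '' Metric.ball x r, pr_open _ Metric.isOpen_ball,
    ⟨x, Metric.mem_ball_self hr, rfl⟩, ?_⟩
  intro b c P hP
  have hb : b ∈ pr '' Metric.ball x r := hP ⟨0, P.source⟩
  have hc' : c ∈ pr '' Metric.ball x r := hP ⟨1, P.target⟩
  obtain ⟨u, hu, rfl⟩ := hb
  obtain ⟨w, hw, rfl⟩ := hc'
  apply Good.of_homotopic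
  let P' : Path (⟨pr u, u, hu, rfl⟩ : pr '' Metric.ball x r) ⟨pr w, w, hw, rfl⟩ :=
    { toFun := fun t => ⟨P t, hP ⟨t, rfl⟩⟩
      continuous_toFun := P.continuous.subtype_mk _
      source' := Subtype.ext P.source
      target' := Subtype.ext P.target }
  have hmem : ∀ t, Path.segment u w t ∈ Metric.ball x r := by
    intro t
    have := (convex_ball x r).segment_subset hu hw
    apply this
    rw [segment_eq_image_lineMap]
    exact ⟨t, t.2, rfl⟩
  let Q' : Path (⟨pr u, u, hu, rfl⟩ : pr '' Metric.ball x r) ⟨pr w, w, hw, rfl⟩ :=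
    { toFun := fun t => ⟨Ph u w t, Path.segment u w t, hmem t, rfl⟩
      continuous_toFun := (Ph u w).continuous.subtype_mk _
      source' := Subtype.ext (Ph u w).source
      target' := Subtype.ext (Ph u w).target }
  exact (SimplyConnectedSpace.paths_homotopic P' Q').map ⟨Subtype.val, continuous_subtype_val⟩

lemma all_good {a b : Y} (P : Path a b) : Good P := by
  choose V hVo hVm hV using local_good
  obtain ⟨t, ht0, htm, ⟨n, hn⟩, ht⟩ := exists_monotone_Icc_subset_open_cover_unitInterval
    (c := fun y : Y => P ⁻¹' V y) (fun y => (hVo y).preimage P.continuous)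
    (fun s _ => Set.mem_iUnion.2 ⟨P s, hVm _⟩)
  have key : ∀ m, Good (P.subpath (t 0) (t m)) := by
    intro m
    induction m with
    | zero => rw [Path.subpath_self]; exact Good.refl _
    | succ m ih =>
      obtain ⟨y, hy⟩ := ht m
      have h2 : Good (P.subpath (t m) (t (m + 1))) := by
        apply hV y
        rw [Path.range_subpath_of_le _ _ _ (htm (Nat.le_succ m))]
        exact Set.image_subset_iff.2 hy
      exact (ih.trans h2).congr ⟨Path.Homotopy.subpathTransSubpath P _ _ _⟩
  have h := key n
  rw [hn n le_rfl, ht0, Path.subpath_zero_one] at h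
  intro x y hx hy
  exact h x y (P.source.trans hx) (P.target.trans hy)

end NilOrb

/-- The orbifold `M̂ = M/ℤ₆`, the quotient of the Heisenberg nilmanifold `M = Γ\G` by the
`ℤ₆`-action generated by `ρ`, is simply connected: it is path-connected and has trivial
fundamental group. -/
theorem stmt19 : SimplyConnectedSpace (Quot nilRel) := by
  rw [simply_connected_iff_paths_homotopic']
  refine ⟨NilOrb.pr_surj.pathConnectedSpace NilOrb.pr.continuous, ?_⟩
  intro a b p q
  obtain ⟨x, rfl⟩ := NilOrb.pr_surj a
  obtain ⟨y, rfl⟩ := NilOrb.pr_surj b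
  exact (NilOrb.all_good p x y rfl rfl).trans (NilOrb.all_good q x y rfl rfl).symm
end
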